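/- arXiv:math/0610988 — 2 statements merged into one kernel-verified Lean document; each statement's English description precedes it below -/
import Mathlib

section
/- Let I be a nontrivial Borel ideal on ℕ such that E_I is Borel reducible to E₁. Then I is isomorphic to one of the following three ideals: (a) Fin, the ideal of all finite subsets of ℕ; (b) Fin ⊕ P(ℕ), realized as {x ⊆ ℕ : x ∩ {2n : n ∈ ℕ} is finite}; (c) I₁ = {x ⊆ ℕ × ℕ : {k : the vertical section x_k = {n : (k,n) ∈ x} is nonempty} is finite}. Here ideals I on a countable set A and J on a countable set B are isomorphic if there is a bijection b : A → B such that for every x ⊆ A, x ∈ I ↔ b[x] ∈ J. -/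
open MeasureTheory

/-- Borel reducibility: a Borel-measurable map `θ` with `E x x' ↔ F (θ x) (θ x')`. -/
def BorelReducible {X Y : Type*} [TopologicalSpace X] [TopologicalSpace Y]
    (E : X → X → Prop) (F : Y → Y → Prop) : Prop :=
  ∃ θ : X → Y, @Measurable X Y (borel X) (borel Y) θ ∧
    ∀ x x' : X, E x x' ↔ F (θ x) (θ x')

/-- An ideal on a countable set `A`, subsets identified with characteristic
functions: contains `∅`, closed under subsets and (finite) unions. -/
def IsIdeal {A : Type*} (I : Set (A → Bool)) : Prop :=
  (fun _ => false) ∈ I ∧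
  (∀ x y : A → Bool, y ∈ I → (∀ a, x a = true → y a = true) → x ∈ I) ∧
  (∀ x y : A → Bool, x ∈ I → y ∈ I → (fun a => x a || y a) ∈ I)

/-- Nontrivial ideal on `ℕ`: contains all singletons and does not contain `ℕ`. -/
def NontrivialIdeal (I : Set (ℕ → Bool)) : Prop :=
  IsIdeal I ∧ (∀ k : ℕ, (fun n => decide (n = k)) ∈ I) ∧ (fun _ => true) ∉ I

/-- The equivalence relation induced by an ideal: `x ∼ y` iff `x Δ y ∈ I`. -/
def EI {A : Type*} (I : Set (A → Bool)) (x y : A → Bool) : Prop :=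
  (fun a => x a != y a) ∈ I

/-- Isomorphism of ideals on countable sets, via a bijection of the underlying sets. -/
def IdealIso {A B : Type*} (I : Set (A → Bool)) (J : Set (B → Bool)) : Prop :=
  ∃ b : A ≃ B, ∀ x : A → Bool, x ∈ I ↔ (fun m => x (b.symm m)) ∈ J

/-- `Fin`: the ideal of finite subsets of `ℕ`. -/
def finIdeal : Set (ℕ → Bool) := {x | {n : ℕ | x n = true}.Finite}

/-- `Fin ⊕ P(ℕ)`, realized as `{x ⊆ ℕ : x ∩ {even numbers} is finite}`. -/
def finPlusFullIdeal : Set (ℕ → Bool) := {x | {n : ℕ | x n = true ∧ Even n}.Finite}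

/-- `I₁`: the ideal of `x ⊆ ℕ × ℕ` with only finitely many nonempty vertical sections. -/
def I1ideal : Set (ℕ × ℕ → Bool) := {x | {k : ℕ | ∃ n, x (k, n) = true}.Finite}

/-- `E₁`: eventual equality on `(2^ℕ)^ℕ`. -/
def E1 (x y : ℕ → ℕ → Bool) : Prop := {k : ℕ | x k ≠ y k}.Finite

open Filter Topology

/-- A measurable map into a second countable space is continuous on a comeager set. -/
theorem Measurable.exists_residual_continuousOn {X Y : Type*}
    [TopologicalSpace X] [MeasurableSpace X] [BorelSpace X]
    [TopologicalSpace Y] [SecondCountableTopology Y] [MeasurableSpace Y] [OpensMeasurableSpace Y]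
    {f : X → Y} (hf : Measurable f) : ∃ D ∈ residual X, ContinuousOn f D := by
  have key : ∀ u : TopologicalSpace.countableBasis Y,
      ∃ o : Set X, IsOpen o ∧ f ⁻¹' u =ᶠ[residual X] o := fun u =>
    (hf (TopologicalSpace.isOpen_of_mem_countableBasis u.2).measurableSet).residualEq_isOpen
  choose o ho hfo using key
  have : Countable (TopologicalSpace.countableBasis Y) :=
    (TopologicalSpace.countable_countableBasis Y).to_subtype
  refine ⟨{x | ∀ u : TopologicalSpace.countableBasis Y, x ∈ f ⁻¹' u ↔ x ∈ o u},
    eventually_countable_forall.2 fun u => eventuallyEq_set.1 (hfo u), ?_⟩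
  intro x hx
  rw [ContinuousWithinAt, (TopologicalSpace.isBasis_countableBasis Y).nhds_hasBasis.tendsto_right_iff]
  rintro v ⟨hv, hxv⟩
  filter_upwards [self_mem_nhdsWithin,
    mem_nhdsWithin_of_mem_nhds ((ho ⟨v, hv⟩).mem_nhds ((hx ⟨v, hv⟩).1 hxv))] with y hy hyo
  exact (hy ⟨v, hv⟩).2 hyo

/-- The symmetric difference of two sets, given by their characteristic functions. -/
def charXor (x a : ℕ → Bool) : ℕ → Bool := fun i => x i != a i

theorem charXor_apply (x a : ℕ → Bool) (i : ℕ) : charXor x a i = (x i != a i) := rfl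

theorem charXor_charXor_cancel (x a : ℕ → Bool) : charXor (charXor x a) a = x := by
  funext i; simp [charXor_apply]

theorem charXor_self_charXor (x a : ℕ → Bool) : charXor x (charXor x a) = a := by
  funext i; simp [charXor_apply]

theorem charXor_assoc (x a b : ℕ → Bool) :
    charXor (charXor x a) b = charXor x (charXor a b) := by
  funext i; simp [charXor_apply]

theorem continuous_charXor : Continuous fun p : (ℕ → Bool) × (ℕ → Bool) => charXor p.1 p.2 := by
  refine continuous_pi fun i => ?_
  have h : Continuous fun p : (ℕ → Bool) × (ℕ → Bool) => (p.1 i, p.2 i) := by fun_prop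
  exact (continuous_of_discreteTopology (f := fun q : Bool × Bool => (q.1 != q.2))).comp h

theorem continuous_charXor_right (a : ℕ → Bool) : Continuous fun x => charXor x a :=
  continuous_charXor.comp (continuous_id.prodMk continuous_const)

theorem continuous_charXor_left (a : ℕ → Bool) : Continuous fun x => charXor a x :=
  continuous_charXor.comp (continuous_const.prodMk continuous_id)

/-- Translation by `a` in the Cantor group. -/
def charXorHomeomorph (a : ℕ → Bool) : (ℕ → Bool) ≃ₜ (ℕ → Bool) where
  toFun x := charXor x a
  invFun x := charXor x a
  left_inv x := charXor_charXor_cancel x a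
  right_inv x := charXor_charXor_cancel x a
  continuous_toFun := continuous_charXor_right a
  continuous_invFun := continuous_charXor_right a

theorem eventually_residual_charXor (a : ℕ → Bool) {p : (ℕ → Bool) → Prop}
    (h : ∀ᶠ x in residual (ℕ → Bool), p x) :
    ∀ᶠ x in residual (ℕ → Bool), p (charXor x a) :=
  (tendsto_residual_of_isOpenMap (charXorHomeomorph a).continuous
    (charXorHomeomorph a).isOpenMap).eventually h

/-- The basic open subset of the Cantor space determined by the first `m` values of `s`. -/
abbrev cantorCylinder (s : ℕ → Bool) (m : ℕ) : Set (ℕ → Bool) :=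
  PiNat.cylinder (E := fun _ => Bool) s m

theorem mem_cantorCylinder {s x : ℕ → Bool} {m : ℕ} :
    x ∈ cantorCylinder s m ↔ ∀ i < m, x i = s i := PiNat.mem_cylinder_iff

theorem cantorCylinder_congr {s t : ℕ → Bool} {m : ℕ} (h : ∀ i < m, s i = t i) :
    cantorCylinder s m = cantorCylinder t m := PiNat.mem_cylinder_iff_eq.1 h

theorem exists_cantorCylinder_subset {u : Set (ℕ → Bool)} (hu : IsOpen u) {x : ℕ → Bool}
    (hx : x ∈ u) : ∃ m, cantorCylinder x m ⊆ u := by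
  obtain ⟨_, ⟨y, m, rfl⟩, hxy, hsub⟩ :=
    (PiNat.isTopologicalBasis_cylinders fun _ : ℕ => Bool).exists_subset_of_mem_open hx hu
  refine ⟨m, ?_⟩
  rwa [← PiNat.mem_cylinder_iff_eq.1 hxy] at hsub

theorem charXor_mem_cantorCylinder {s x a : ℕ → Bool} {m : ℕ} :
    charXor x a ∈ cantorCylinder s m ↔ x ∈ cantorCylinder (charXor s a) m := by
  simp only [mem_cantorCylinder, charXor_apply]
  refine forall₂_congr fun i _ => ?_
  cases x i <;> cases a i <;> cases s i <;> simp

/-- The set of `a` such that translating by `a` does not affect the values of `θ` from index `n`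
on, for generic points of `V`. -/
def genericStabilizer (θ : (ℕ → Bool) → ℕ → ℕ → Bool) (n : ℕ) (V : Set (ℕ → Bool)) :
    Set (ℕ → Bool) :=
  {a | ∀ᶠ x in residual (ℕ → Bool), x ∈ V → ∀ k, n ≤ k → θ (charXor x a) k = θ x k}

section GenericStabilizer

variable {θ : (ℕ → Bool) → ℕ → ℕ → Bool}

theorem genericStabilizer_anti {n : ℕ} {V W : Set (ℕ → Bool)} (h : W ⊆ V) :
    genericStabilizer θ n V ⊆ genericStabilizer θ n W :=
  fun _ (ha : ∀ᶠ _ in residual (ℕ → Bool), _ → _) => ha.mono fun _ hx hxW => hx (h hxW)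

theorem isClosed_genericStabilizer (hθ : Measurable θ) (n : ℕ) (V : Set (ℕ → Bool)) :
    IsClosed (genericStabilizer θ n V) := by
  obtain ⟨D, hD, hcont⟩ := hθ.exists_residual_continuousOn
  refine IsSeqClosed.isClosed fun a b ha hab => ?_
  have h1 : ∀ᶠ x in residual (ℕ → Bool), ∀ i, x ∈ V → ∀ k, n ≤ k →
      θ (charXor x (a i)) k = θ x k := eventually_countable_forall.2 ha
  have h2 : ∀ᶠ x in residual (ℕ → Bool), ∀ i, charXor x (a i) ∈ D :=
    eventually_countable_forall.2 fun i => eventually_residual_charXor (a i) hD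
  filter_upwards [h1, h2, eventually_residual_charXor b hD] with x hx1 hx2 hx3 hxV k hk
  have hlim : Tendsto (fun i => θ (charXor x (a i))) atTop (𝓝 (θ (charXor x b))) := by
    refine (hcont _ hx3).tendsto.comp (tendsto_nhdsWithin_iff.2 ⟨?_, Eventually.of_forall hx2⟩)
    exact ((continuous_charXor_left x).tendsto b).comp hab
  refine tendsto_nhds_unique ((tendsto_pi_nhds.1 hlim k)) ?_
  simp only [hx1 _ hxV k hk, tendsto_const_nhds]

theorem charXor_mem_genericStabilizer {n m : ℕ} {s a b : ℕ → Bool}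
    (ha : a ∈ genericStabilizer θ n (cantorCylinder s m))
    (hb : b ∈ genericStabilizer θ n (cantorCylinder s m)) :
    charXor a b ∈ genericStabilizer θ n (cantorCylinder (charXor s a) m) := by
  filter_upwards [eventually_residual_charXor a ha, eventually_residual_charXor a hb]
    with x hxa hxb hx k hk
  have hmem := charXor_mem_cantorCylinder.2 hx
  rw [← charXor_assoc, hxb hmem k hk, ← hxa hmem k hk, charXor_charXor_cancel]

theorem zero_mem_genericStabilizer (n : ℕ) (V : Set (ℕ → Bool)) :
    (fun _ => false) ∈ genericStabilizer θ n V := by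
  refine Eventually.of_forall (f := residual (ℕ → Bool)) fun x _ k _ => ?_
  congr 1
  funext i
  simp [charXor_apply]

theorem genericStabilizer_subset {I : Set (ℕ → Bool)} (hred : ∀ x y, EI I x y ↔ E1 (θ x) (θ y))
    (n m : ℕ) (s : ℕ → Bool) : genericStabilizer θ n (cantorCylinder s m) ⊆ I := by
  intro a ha
  obtain ⟨x, hxV, hx⟩ := (dense_of_mem_residual ha).inter_open_nonempty _
    (PiNat.isOpen_cylinder (fun _ => Bool) s m) ⟨s, PiNat.self_mem_cylinder s m⟩
  have h : EI I x (charXor x a) := by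
    refine (hred _ _).2 ((Set.finite_lt_nat n).subset fun k hk => ?_)
    by_contra hkn
    exact hk (hx hxV k (not_lt.1 hkn)).symm
  have h' : charXor x (charXor x a) ∈ I := h
  rwa [charXor_self_charXor] at h'

theorem exists_mem_genericStabilizer (hθ : Measurable θ) {I : Set (ℕ → Bool)}
    (hred : ∀ x y, EI I x y ↔ E1 (θ x) (θ y)) {a : ℕ → Bool} (ha : a ∈ I) :
    ∃ n s m, a ∈ genericStabilizer θ n (cantorCylinder s m) := by
  let S : ℕ → Set (ℕ → Bool) := fun n => {x | ∀ k, n ≤ k → θ (charXor x a) k = θ x k}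
  have hS : ∀ n, MeasurableSet (S n) := by
    intro n
    have h1 : Measurable fun x => θ (charXor x a) :=
      hθ.comp (continuous_charXor_right a).measurable
    have : S n = ⋂ k, ⋂ _ : n ≤ k, {x | θ (charXor x a) k = θ x k} := by
      ext x; simp [S]
    rw [this]
    refine MeasurableSet.iInter fun k => MeasurableSet.iInter fun _ => ?_
    exact measurableSet_eq_fun ((measurable_pi_apply k).comp h1) ((measurable_pi_apply k).comp hθ)
  choose u hu hSu using fun n => (hS n).residualEq_isOpen
  have hcover : ∀ x, ∃ n, x ∈ S n := by
    intro x
    have h : EI I x (charXor x a) := by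
      change charXor x (charXor x a) ∈ I
      rwa [charXor_self_charXor]
    obtain ⟨N, hN⟩ := ((hred _ _).1 h).bddAbove
    refine ⟨N + 1, fun k hk => ?_⟩
    by_contra hne
    have := hN (show k ∈ {k | θ x k ≠ θ (charXor x a) k} from Ne.symm hne)
    omega
  obtain ⟨x, hx⟩ := (dense_of_mem_residual (eventually_countable_forall.2
    fun n => eventuallyEq_set.1 (hSu n))).nonempty
  obtain ⟨n, hn⟩ := hcover x
  obtain ⟨m, hm⟩ := exists_cantorCylinder_subset (hu n) ((hx n).1 hn)
  refine ⟨n, x, m, ?_⟩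
  filter_upwards [eventuallyEq_set.1 (hSu n)] with y hy hyV
  exact hy.2 (hm hyV)

theorem exists_singletons_mem_genericStabilizer (hθ : Measurable θ) {I : Set (ℕ → Bool)}
    (hI : IsIdeal I) (hred : ∀ x y, EI I x y ↔ E1 (θ x) (θ y)) {a : ℕ → Bool} (ha : a ∈ I) :
    ∃ n s m, ∀ k, m ≤ k → a k = true →
      (fun i => decide (i = k)) ∈ genericStabilizer θ n (cantorCylinder s m) := by
  let ev : ℕ × ℕ × Finset ℕ → Set (ℕ → Bool) := fun p =>
    genericStabilizer θ p.1 (cantorCylinder (fun i => decide (i ∈ p.2.2)) p.2.1)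
  let T : ℕ × ℕ × Finset ℕ → Set (ℕ → Bool) := fun p => {c | (fun i => c i && a i) ∈ ev p}
  have hcont : Continuous fun c : ℕ → Bool => fun i => c i && a i :=
    continuous_pi fun i => (continuous_of_discreteTopology (f := fun q : Bool => q && a i)).comp
      (continuous_apply i)
  have hT : ∀ p, IsClosed (T p) := fun p =>
    (isClosed_genericStabilizer hθ _ _).preimage hcont
  have hU : ⋃ p, T p = Set.univ := by
    refine Set.eq_univ_of_forall fun c => ?_
    obtain ⟨n, s, m, h⟩ := exists_mem_genericStabilizer hθ hred
      (hI.2.1 (fun i => c i && a i) a ha fun i hi => by simp_all)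
    refine Set.mem_iUnion.2 ⟨(n, m, (Finset.range m).filter fun i => s i = true), ?_⟩
    change _ ∈ genericStabilizer θ n (cantorCylinder _ m)
    rwa [cantorCylinder_congr (t := s)]
    intro i hi
    simp [hi]
  obtain ⟨⟨n, m, F⟩, t, ht⟩ := nonempty_interior_of_iUnion_of_closed hT hU
  obtain ⟨l, hl⟩ := exists_cantorCylinder_subset isOpen_interior ht
  set s : ℕ → Bool := fun i => decide (i ∈ F)
  have hmem : ∀ c ∈ cantorCylinder t l, (fun i => c i && a i) ∈
      genericStabilizer θ n (cantorCylinder s (max l m)) := fun c hc =>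
    genericStabilizer_anti (PiNat.cylinder_anti s (le_max_right l m))
      (interior_subset (hl hc) : c ∈ T (n, m, F))
  refine ⟨n, charXor s (fun i => t i && a i), max l m, fun k hk hak => ?_⟩
  have h := charXor_mem_genericStabilizer (hmem t (PiNat.self_mem_cylinder t l))
    (hmem (Function.update t k (!t k)) ?_)
  · convert h using 1
    funext i
    by_cases hik : i = k
    · subst hik
      simp [charXor_apply, hak]
    · simp [charXor_apply, hik]
  · rw [mem_cantorCylinder]
    intro i hi
    have : i ≠ k := by have := le_max_left l m; omega
    simp [this]

open Classical in
theorem union_singletons_mem_genericStabilizer (hθ : Measurable θ) (n m : ℕ) (s : ℕ → Bool) :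
    (fun k => decide (m ≤ k ∧ (fun i => decide (i = k)) ∈
      genericStabilizer θ n (cantorCylinder s m))) ∈ genericStabilizer θ n (cantorCylinder s m) := by
  set G := genericStabilizer θ n (cantorCylinder s m) with hG
  set P : ℕ → Prop := fun k => m ≤ k ∧ (fun i => decide (i = k)) ∈ G with hP
  have hfin : ∀ N, (fun k => decide (k < N ∧ P k)) ∈ G := by
    intro N
    induction N with
    | zero => simpa using zero_mem_genericStabilizer n _
    | succ N ih =>
      by_cases hN : P N
      · have h := charXor_mem_genericStabilizer ih hN.2
        rw [cantorCylinder_congr (t := s)] at h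
        · convert h using 1
          funext k
          rcases lt_trichotomy k N with hk | rfl | hk
          · simp [charXor_apply, hk, hk.ne, hk.trans (Nat.lt_succ_self N)]
          · simp [charXor_apply, hN]
          · have h1 : ¬ k < N + 1 := by omega
            simp [charXor_apply, h1, hk.ne', hk.not_gt]
        · intro i hi
          have : ¬ P i := fun h => absurd h.1 (not_le.2 hi)
          simp [charXor_apply, this]
      · convert ih using 1
        funext k
        by_cases hk : k = N
        · subst hk; simp [hN]
        · have : k < N + 1 ↔ k < N := by omega
          simp [this]
  refine (isClosed_genericStabilizer hθ n _).mem_of_tendsto (b := atTop) ?_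
    (Eventually.of_forall hfin)
  refine tendsto_pi_nhds.2 fun k => tendsto_const_nhds.congr' ?_
  filter_upwards [eventually_gt_atTop k] with N hN
  simp [hN, hP]

end GenericStabilizer

theorem initial_segment_mem_ideal {I : Set (ℕ → Bool)} (hI : NontrivialIdeal I) (m : ℕ) :
    (fun i => decide (i < m)) ∈ I := by
  induction m with
  | zero => simpa using hI.1.1
  | succ m ih =>
    convert hI.1.2.2 _ _ ih (hI.2.1 m) using 1
    funext i
    simp only [← Bool.decide_or]
    congr 1
    exact propext Nat.lt_succ_iff_lt_or_eq

/-- An ideal whose induced equivalence relation is Borel reducible to `E₁` is countably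
generated. -/
theorem countably_generated_of_borelReducible_E1 {I : Set (ℕ → Bool)} (hI : NontrivialIdeal I)
    (hred : BorelReducible (EI I) E1) :
    ∃ B : ℕ → ℕ → Bool, (∀ j, B j ∈ I) ∧
      ∀ a ∈ I, ∃ j, ∀ i, a i = true → B j i = true := by
  classical
  obtain ⟨θ, hθ, hred⟩ := hred
  rw [← (inferInstance : BorelSpace (ℕ → Bool)).measurable_eq,
    ← (inferInstance : BorelSpace (ℕ → ℕ → Bool)).measurable_eq] at hθ
  let C : ℕ × ℕ × Finset ℕ → ℕ → Bool := fun p k =>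
    decide (k < p.2.1) || decide (p.2.1 ≤ k ∧ (fun i => decide (i = k)) ∈
      genericStabilizer θ p.1 (cantorCylinder (fun i => decide (i ∈ p.2.2)) p.2.1))
  obtain ⟨e, he⟩ := exists_surjective_nat (ℕ × ℕ × Finset ℕ)
  refine ⟨fun j => C (e j), fun j => hI.1.2.2 _ _ (initial_segment_mem_ideal hI _)
    (genericStabilizer_subset hred _ _ _ (union_singletons_mem_genericStabilizer hθ _ _ _)), ?_⟩
  intro a ha
  obtain ⟨n, s, m, h⟩ := exists_singletons_mem_genericStabilizer hθ hI.1 hred ha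
  obtain ⟨j, hj⟩ := he (n, m, (Finset.range m).filter fun i => s i = true)
  refine ⟨j, fun i hi => ?_⟩
  simp only [hj, C]
  by_cases him : i < m
  · simp [him]
  · have := h i (not_lt.1 him) hi
    rw [cantorCylinder_congr (t := fun i => decide (i ∈ (Finset.range m).filter
      fun i => s i = true))] at this
    · simp only [this, not_lt.1 him]
      simp
    · intro i hi
      simp [hi]

theorem exists_rank_of_countably_generated {I : Set (ℕ → Bool)} (hI : NontrivialIdeal I)
    {B : ℕ → ℕ → Bool} (hB : ∀ j, B j ∈ I)
    (hgen : ∀ a ∈ I, ∃ j, ∀ i, a i = true → B j i = true) :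
    ∃ r : ℕ → ℕ, ∀ x, x ∈ I ↔ ∃ N, ∀ i, x i = true → r i ≤ N := by
  classical
  have hex : ∀ i, ∃ j, B j i = true := fun i => by
    obtain ⟨j, hj⟩ := hgen _ (hI.2.1 i)
    exact ⟨j, hj i (by simp)⟩
  have hle : ∀ N, (fun i => decide (Nat.find (hex i) ≤ N)) ∈ I := by
    intro N
    induction N with
    | zero =>
      refine hI.1.2.1 _ _ (hB 0) fun i hi => ?_
      have h := Nat.find_spec (hex i)
      rwa [Nat.le_zero.1 (of_decide_eq_true hi)] at h
    | succ N ih =>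
      refine hI.1.2.1 _ _ (hI.1.2.2 _ _ ih (hB (N + 1))) fun i hi => ?_
      rcases Nat.le_succ_iff.1 (of_decide_eq_true hi) with h | h
      · simp [-Nat.find_le_iff, h]
      · have h' := Nat.find_spec (hex i)
        rw [h] at h'
        simp [h']
  refine ⟨fun i => Nat.find (hex i), fun x => ⟨fun hx => ?_, fun ⟨N, hN⟩ => ?_⟩⟩
  · obtain ⟨j, hj⟩ := hgen x hx
    exact ⟨j, fun i hi => Nat.find_min' _ (hj i hi)⟩
  · exact hI.1.2.1 _ _ (hle N) fun i hi => decide_eq_true (hN i hi)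

theorem idealIso_finPlusFullIdeal {I : Set (ℕ → Bool)} {S : Set ℕ} (hS : S.Infinite)
    (hSc : Sᶜ.Infinite) (h : ∀ x, x ∈ I ↔ {i | x i = true ∧ i ∈ S}.Finite) :
    IdealIso I finPlusFullIdeal := by
  classical
  have hE : {n : ℕ | Even n}.Infinite :=
    Set.infinite_of_injective_forall_mem (f := fun n => 2 * n) (fun a b h => by simpa using h)
      fun n => by simp
  have hO : {n : ℕ | ¬ Even n}.Infinite :=
    Set.infinite_of_injective_forall_mem (f := fun n => 2 * n + 1) (fun a b h => by simpa using h)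
      fun n => by simp
  have := hS.to_subtype
  have := hSc.to_subtype
  have := hE.to_subtype
  have := hO.to_subtype
  obtain ⟨e₁⟩ : Nonempty (S ≃ {n : ℕ | Even n}) := nonempty_equiv_of_countable
  obtain ⟨e₂⟩ : Nonempty ((Sᶜ : Set ℕ) ≃ {n : ℕ | ¬ Even n}) := nonempty_equiv_of_countable
  let b : ℕ ≃ ℕ := Equiv.subtypeCongr (p := (· ∈ S)) (q := Even) e₁ e₂
  have hb : ∀ i, Even (b i) ↔ i ∈ S := by
    intro i
    by_cases hi : i ∈ S
    · simp only [hi, iff_true]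
      have : b i = e₁ ⟨i, hi⟩ := by simp [b, Equiv.subtypeCongr, hi]
      rw [this]; exact (e₁ ⟨i, hi⟩).2
    · simp only [hi, iff_false]
      have : b i = e₂ ⟨i, hi⟩ := by simp [b, Equiv.subtypeCongr, hi]
      rw [this]; exact (e₂ ⟨i, hi⟩).2
  refine ⟨b, fun x => (h x).trans ?_⟩
  have : {i | x i = true ∧ i ∈ S} = b ⁻¹' {m | x (b.symm m) = true ∧ Even m} := by
    ext i; simp [hb]
  rw [this, ← b.image_symm_eq_preimage, Set.finite_image_iff b.symm.injective.injOn]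
  rfl

theorem idealIso_I1ideal {I : Set (ℕ → Bool)} {r : ℕ → ℕ} (hr : ∀ k, {i | r i = k}.Infinite)
    (h : ∀ x, x ∈ I ↔ ∃ N, ∀ i, x i = true → r i ≤ N) : IdealIso I I1ideal := by
  have he : ∀ k, Nonempty ({i // r i = k} ≃ ℕ) := fun k => by
    have : Infinite {i // r i = k} := (hr k).to_subtype
    exact nonempty_equiv_of_countable
  let e := fun k => (he k).some
  let b : ℕ ≃ ℕ × ℕ := (Equiv.sigmaFiberEquiv r).symm.trans
    ((Equiv.sigmaCongrRight e).trans (Equiv.sigmaEquivProd ℕ ℕ))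
  have hb : ∀ i, (b i).1 = r i := fun i => rfl
  refine ⟨b, fun x => (h x).trans ?_⟩
  have himage : {k | ∃ n, x (b.symm (k, n)) = true} = r '' {i | x i = true} := by
    ext k
    constructor
    · rintro ⟨n, hn⟩
      exact ⟨b.symm (k, n), hn, by rw [← hb, Equiv.apply_symm_apply]⟩
    · rintro ⟨i, hi, rfl⟩
      exact ⟨(b i).2, by rw [← hb, Prod.mk.eta, Equiv.symm_apply_apply]; exact hi⟩
  change _ ↔ {k | ∃ n, x (b.symm (k, n)) = true}.Finite
  rw [himage, Set.finite_iff_bddAbove]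
  simp [BddAbove, Set.Nonempty, upperBounds]

theorem idealIso_of_rank {I : Set (ℕ → Bool)} (hI : NontrivialIdeal I) {r : ℕ → ℕ}
    (h : ∀ x, x ∈ I ↔ ∃ N, ∀ i, x i = true → r i ≤ N) :
    IdealIso I finIdeal ∨ IdealIso I finPlusFullIdeal ∨ IdealIso I I1ideal := by
  classical
  have hbdd : ∀ {s : Set ℕ}, s.Finite → ∃ N, ∀ i ∈ s, r i ≤ N := fun {s} hs => by
    obtain ⟨N, hN⟩ := (hs.image r).bddAbove
    exact ⟨N, fun i hi => hN ⟨i, hi, rfl⟩⟩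
  by_cases hfin : ∀ N, {i | r i ≤ N}.Finite
  · refine Or.inl ⟨Equiv.refl ℕ, fun x => (h x).trans ⟨?_, fun hx => hbdd hx⟩⟩
    rintro ⟨N, hN⟩
    exact (hfin N).subset hN
  push Not at hfin
  obtain ⟨N₀, hN₀⟩ := hfin
  refine Or.inr ?_
  by_cases hstab : ∃ N₁, {i | r i ≤ N₁}.Infinite ∧ ∀ N, {i | N₁ < r i ∧ r i ≤ N}.Finite
  · obtain ⟨N₁, hinf, hfin⟩ := hstab
    refine Or.inl (idealIso_finPlusFullIdeal (S := {i | N₁ < r i}) ?_ ?_ fun x => (h x).trans ?_)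
    · intro hS
      obtain ⟨N, hN⟩ := hbdd hS
      refine hI.2.2 ((h _).2 ⟨max N₁ N, fun i _ => ?_⟩)
      by_cases hi : N₁ < r i
      · exact (hN i hi).trans (le_max_right _ _)
      · exact (not_lt.1 hi).trans (le_max_left _ _)
    · convert hinf using 1
      ext i
      simp
    · constructor
      · rintro ⟨N, hN⟩
        exact (hfin N).subset fun i hi => ⟨hi.2, hN i hi.1⟩
      · intro hx
        obtain ⟨N, hN⟩ := hbdd hx
        refine ⟨max N₁ N, fun i hxi => ?_⟩
        by_cases hi : N₁ < r i
        · exact (hN i ⟨hxi, hi⟩).trans (le_max_right _ _)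
        · exact (not_lt.1 hi).trans (le_max_left _ _)
  · have hstep : ∀ N, ∃ M, {i | r i ≤ N}.Infinite → {i | N < r i ∧ r i ≤ M}.Infinite := by
      intro N
      by_cases hN : {i | r i ≤ N}.Infinite
      · by_contra hcon
        push Not at hcon
        exact hstab ⟨N, hN, fun M => (hcon M).2⟩
      · exact ⟨0, fun h => absurd h hN⟩
    choose g hg using hstep
    let f : ℕ → ℕ := fun k => g^[k] N₀
    have hf : ∀ k, f (k + 1) = g (f k) := fun k => Function.iterate_succ_apply' g k N₀
    have hinf : ∀ k, {i | r i ≤ f k}.Infinite := by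
      intro k
      induction k with
      | zero => exact hN₀
      | succ k ih =>
        rw [hf]
        exact (hg _ ih).mono fun i hi => hi.2
    have hlayer : ∀ k, {i | f k < r i ∧ r i ≤ f (k + 1)}.Infinite := fun k => by
      rw [hf]
      exact hg _ (hinf k)
    have hmono : StrictMono f := strictMono_nat_of_lt_succ fun k => by
      obtain ⟨i, hi⟩ := (hlayer k).nonempty
      exact hi.1.trans_le hi.2
    have hex : ∀ i, ∃ k, r i ≤ f k := fun i => ⟨r i, hmono.le_apply⟩
    refine Or.inr (idealIso_I1ideal (r := fun i => Nat.find (hex i)) ?_ fun x => (h x).trans ?_)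
    · rintro (_ | k)
      · exact hN₀.mono fun i hi => (Nat.find_eq_zero (hex i)).2 hi
      · refine (hlayer k).mono fun i hi => (Nat.find_eq_iff (hex i)).2 ⟨hi.2, fun n hn => ?_⟩
        exact not_le.2 ((hmono.monotone (Nat.lt_succ_iff.1 hn)).trans_lt hi.1)
    · constructor
      · rintro ⟨N, hN⟩
        exact ⟨N, fun i hi => Nat.find_min' _ ((hN i hi).trans hmono.le_apply)⟩
      · rintro ⟨N, hN⟩
        exact ⟨f N, fun i hi => (Nat.find_spec (hex i)).trans (hmono.monotone (hN i hi))⟩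

/-- Kechris: any nontrivial Borel ideal `I` on `ℕ` with `E_I ≤B E₁` is
isomorphic to `Fin`, to `Fin ⊕ P(ℕ)`, or to `I₁`. -/
theorem ideals_below_E1
    (I : Set (ℕ → Bool)) (hI : NontrivialIdeal I)
    (hBorel : MeasurableSet[borel (ℕ → Bool)] I)
    (hred : BorelReducible (EI I) E1) :
    IdealIso I finIdeal ∨ IdealIso I finPlusFullIdeal ∨ IdealIso I I1ideal := by
  obtain ⟨B, hB, hgen⟩ := countably_generated_of_borelReducible_E1 hI hred
  obtain ⟨r, hr⟩ := exists_rank_of_countably_generated hI hB hgen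
  exact idealIso_of_rank hI hr
end

section
/- Let I be a nontrivial Borel ideal on ℕ such that E_I is Borel reducible to E₃. Then I is isomorphic to one of the following three ideals: (a) Fin, the ideal of all finite subsets of ℕ; (b) Fin ⊕ P(ℕ), realized as {x ⊆ ℕ : x ∩ {2n : n ∈ ℕ} is finite}; (c) I₃ = {x ⊆ ℕ × ℕ : every vertical section x_k = {n : (k,n) ∈ x} is finite}. Here ideals I on a countable set A and J on a countable set B are isomorphic if there is a bijection b : A → B such that for every x ⊆ A, x ∈ I ↔ b[x] ∈ J. -/
open MeasureTheory

/-- `I₃`: the ideal of `x ⊆ ℕ × ℕ` all of whose vertical sections are finite. -/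
def I3ideal : Set (ℕ × ℕ → Bool) := {x | ∀ k : ℕ, {n : ℕ | x (k, n) = true}.Finite}

/-- `E₃`: componentwise eventual equality on `(2^ℕ)^ℕ`. -/
def E3 (x y : ℕ → ℕ → Bool) : Prop := ∀ k : ℕ, {n : ℕ | x k n ≠ y k n}.Finite

open Filter Topology Set PiNat

section Baire

/-- If two maps into `2^ℕ`, continuous on a comeager set, agree from some index on at each point of
an open set, then that index can be chosen uniformly on a smaller open set. -/
theorem exists_open_uniform_tail {X : Type*} [TopologicalSpace X] [BaireSpace X] {E U : Set X}
    (hE : E ∈ residual X) (hU : IsOpen U) (hne : U.Nonempty) {g h : X → ℕ → Bool}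
    (hg : ContinuousOn g E) (hh : ContinuousOn h E)
    (hcov : ∀ p ∈ U, p ∈ E → ∃ N, ∀ n ≥ N, g p n = h p n) :
    ∃ N V, IsOpen V ∧ V.Nonempty ∧ V ⊆ U ∧ ∀ p ∈ V, p ∈ E → ∀ n ≥ N, g p n = h p n := by
  let Q : ℕ → Set X := fun N => E ∩ {p | ∀ n ≥ N, g p n = h p n}
  have hQ : ∀ N, ∀ p ∈ E, p ∈ closure (Q N) → ∀ n ≥ N, g p n = h p n := by
    intro N p hp hc n hn
    have := mem_closure_iff_nhdsWithin_neBot.1 hc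
    have hle : 𝓝[Q N] p ≤ 𝓝[E] p := nhdsWithin_mono _ inter_subset_left
    have h1 := ((continuous_apply n).tendsto (g p)).comp ((hg p hp).mono_left hle)
    have h2 := ((continuous_apply n).tendsto (h p)).comp ((hh p hp).mono_left hle)
    refine tendsto_nhds_unique h1 (h2.congr' ?_)
    filter_upwards [self_mem_nhdsWithin] with q hq
    exact (hq.2 n hn).symm
  obtain ⟨s, hsE, hs, hsd⟩ := mem_residual.1 hE
  let C : Option ℕ → Set X := fun o => o.elim Uᶜ fun N => closure (Q N)
  have hd := hs.dense_iUnion_interior_of_closed hsd (f := C)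
    (by rintro (_ | N); exacts [hU.isClosed_compl, isClosed_closure]) (by
      intro p hp
      rw [mem_iUnion]
      by_cases hpU : p ∈ U
      · obtain ⟨N, hN⟩ := hcov p hpU (hsE hp)
        exact ⟨some N, subset_closure ⟨hsE hp, hN⟩⟩
      · exact ⟨none, hpU⟩)
  obtain ⟨p, hpU, hp⟩ := hd.inter_open_nonempty U hU hne
  obtain ⟨_ | N, hpN⟩ := mem_iUnion.1 hp
  · exact absurd hpU (interior_subset hpN)
  · exact ⟨N, U ∩ interior (closure (Q N)), hU.inter isOpen_interior, ⟨p, hpU, hpN⟩,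
      inter_subset_left, fun q hq hqE => hQ N q hqE (interior_subset hq.2)⟩

/-- A Borel map into `2^ℕ` is continuous on a comeager set. -/
theorem exists_residual_continuousOn {X : Type*} [TopologicalSpace X] {f : X → ℕ → Bool}
    (hf : ∀ n, MeasurableSet[borel X] {x | f x n = true}) :
    ∃ D ∈ residual X, ContinuousOn f D := by
  borelize X
  have hO := fun n => (hf n).residualEq_isOpen
  have hO' := fun n => (hf n).compl.residualEq_isOpen
  choose u hu hue using hO
  choose v hv hve using hO'
  refine ⟨{x | ∀ n, (x ∈ {x | f x n = true} ↔ x ∈ u n) ∧ (x ∈ {x | f x n = true}ᶜ ↔ x ∈ v n)},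
    ?_, ?_⟩
  · exact eventually_countable_forall.2 fun n =>
      ((eventuallyEq_set.1 (hue n)).and (eventuallyEq_set.1 (hve n)))
  · refine continuousOn_pi.2 fun n x hx => ?_
    refine tendsto_nhds_of_eventually_eq ?_
    rcases hfx : f x n with _ | _
    · filter_upwards [self_mem_nhdsWithin,
        mem_nhdsWithin_of_mem_nhds ((hv n).mem_nhds ((hx n).2.1 (by simp [hfx])))] with y hy hyv
      rw [hfx]
      simpa using (hy n).2.2 hyv
    · filter_upwards [self_mem_nhdsWithin,
        mem_nhdsWithin_of_mem_nhds ((hu n).mem_nhds ((hx n).1.1 (by simp [hfx])))] with y hy hyu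
      rw [hfx]
      exact (hy n).1.2 hyu

theorem eq_of_tendsto_of_continuousOn {X : Type*} [TopologicalSpace X] {f : X → ℕ → Bool}
    {D : Set X} (hf : ContinuousOn f D) {u : ℕ → X} {y : X} {v : ℕ → Bool} (hu : ∀ j, u j ∈ D)
    (hy : y ∈ D) (hlim : Tendsto u atTop (𝓝 y)) (hv : ∀ᶠ j in atTop, f (u j) = v) : f y = v :=
  tendsto_nhds_unique
    ((hf y hy).tendsto.comp (tendsto_nhdsWithin_iff.2 ⟨hlim, Eventually.of_forall hu⟩))
    (tendsto_const_nhds.congr' (hv.mono fun _ h => h.symm))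

end Baire

section Cantor

theorem exists_cylinder_subset {U : Set (ℕ → Bool)} (hU : IsOpen U) {y : ℕ → Bool} (hy : y ∈ U)
    (n : ℕ) : ∃ r ≥ n, cylinder y r ⊆ U := by
  obtain ⟨_, ⟨x, k, rfl⟩, hyx, hsub⟩ :=
    (isTopologicalBasis_cylinders (E := fun _ : ℕ => Bool)).exists_subset_of_mem_open hy hU
  refine ⟨max n k, le_max_left _ _, ?_⟩
  rw [← mem_cylinder_iff_eq.1 hyx] at hsub
  exact (cylinder_anti y (le_max_right _ _)).trans hsub

theorem add_mem_cylinder {x y z : ℕ → Bool} {n : ℕ} (hy : y ∈ cylinder x n)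
    (hz : ∀ i < n, z i = false) : y + z ∈ cylinder x n := by
  intro i hi
  have := hy i hi
  simp [hz i hi, this, Bool.add_eq_xor]

theorem single_eq_false {m n : ℕ} (h : n ≤ m) : ∀ i < n, (Pi.single m true : ℕ → Bool) i = false :=
  fun i hi => Pi.single_eq_of_ne (by omega) _

theorem single_mem_finIdeal (m : ℕ) : (Pi.single m true : ℕ → Bool) ∈ finIdeal :=
  (finite_singleton m).subset fun i hi => by
    by_contra h
    have : (Pi.single m true : ℕ → Bool) i = false := Pi.single_eq_of_ne h _
    simp_all

theorem add_mem_finIdeal {x y : ℕ → Bool} (hx : x ∈ finIdeal) (hy : y ∈ finIdeal) :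
    x + y ∈ finIdeal :=
  (Set.Finite.union hx hy).subset fun i hi => by
    change (x i ^^ y i) = true at hi
    change x i = true ∨ y i = true
    revert hi
    cases x i <;> cases y i <;> simp

theorem finIdeal_of_eventually {x : ℕ → Bool} {n : ℕ} (h : ∀ i ≥ n, x i = false) :
    x ∈ finIdeal :=
  (finite_lt_nat n).subset fun i hi => by
    by_contra hin
    have := h i (not_lt.1 hin)
    simp_all

theorem add_add_cancel_self (x y : ℕ → Bool) : x + y + y = x := by
  have h : y + y = 0 := funext fun i => BooleanRing.add_self (y i)
  rw [add_assoc, h, add_zero]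

theorem exists_invariant_residual {D : Set (ℕ → Bool)} (hD : D ∈ residual (ℕ → Bool)) :
    {y | ∀ z ∈ finIdeal, y + z ∈ D} ∈ residual (ℕ → Bool) := by
  have hc : finIdeal.Countable := by
    refine (countable_range fun (F : Finset ℕ) i => decide (i ∈ F)).mono fun z hz => ?_
    have hz : {n : ℕ | z n = true}.Finite := hz
    exact ⟨hz.toFinset, funext fun i => by simp⟩
  refine (eventually_countable_ball hc).2 fun z _ => ?_
  have := (Homeomorph.addRight z).residual_map_eq
  rw [← this] at hD
  exact hD

end Cantor

section Stable

/-- The positions `m ≥ n` such that flipping the `m`-th bit does not change the value of `f` on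
`D ∩ cylinder a n`. -/
def stableSet (f : (ℕ → Bool) → ℕ → Bool) (D : Set (ℕ → Bool)) (a : ℕ → Bool) (n : ℕ) : Set ℕ :=
  {m | n ≤ m ∧ ∀ y ∈ D, y ∈ cylinder a n → f (y + Pi.single m true) = f y}

variable {f : (ℕ → Bool) → ℕ → Bool} {D : Set (ℕ → Bool)}

theorem cylinder_subset_cylinder {a b : ℕ → Bool} {n r : ℕ} (hb : b ∈ cylinder a n) (hr : n ≤ r) :
    cylinder b r ⊆ cylinder a n :=
  (cylinder_anti b hr).trans (mem_cylinder_iff_eq.1 hb).subset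

theorem stableSet_mono {a b : ℕ → Bool} {n r m : ℕ} (hb : b ∈ cylinder a n) (hr : n ≤ r)
    (hm : m ∈ stableSet f D a n) (hrm : r ≤ m) : m ∈ stableSet f D b r :=
  ⟨hrm, fun y hy hyb => hm.2 y hy (cylinder_subset_cylinder hb hr hyb)⟩

theorem exists_cylinder_eqOn_initial (hf : ContinuousOn f D) {y : ℕ → Bool} (hy : y ∈ D)
    (n N : ℕ) : ∃ r ≥ n, ∀ y' ∈ D, y' ∈ cylinder y r → ∀ i < N, f y' i = f y i := by
  have h : ∀ᶠ y' in 𝓝[D] y, f y' ∈ cylinder (f y) N :=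
    hf y hy ((isOpen_cylinder _ (f y) N).mem_nhds (self_mem_cylinder _ _))
  obtain ⟨u, hu, hyu, hsub⟩ := mem_nhdsWithin.1 h
  obtain ⟨r, hr, hru⟩ := exists_cylinder_subset hu hyu n
  exact ⟨r, hr, fun y' hy' hc => hsub ⟨hru hc, hy'⟩⟩

/-- If flips inside `x` preserve `f` modulo finite sets, then almost all elements of `x` are stable
for some cylinder below any given one. -/
theorem exists_stable_cylinder (hD : D ∈ residual (ℕ → Bool))
    (hinv : ∀ y ∈ D, ∀ z ∈ finIdeal, y + z ∈ D) (hf : ContinuousOn f D) {x : ℕ → Bool}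
    (hx : ∀ y z, ∃ N, ∀ i ≥ N, f y i = f (y + z * x) i) (a : ℕ → Bool) (n : ℕ) :
    ∃ b r, n ≤ r ∧ b ∈ cylinder a n ∧ ∀ m ≥ r, x m = true → m ∈ stableSet f D b r := by
  let T : (ℕ → Bool) × (ℕ → Bool) ≃ₜ (ℕ → Bool) × (ℕ → Bool) :=
    { toFun := fun p => (p.1, p.2 + p.1 * x)
      invFun := fun p => (p.1, p.2 + p.1 * x)
      left_inv := fun p => Prod.ext rfl (add_add_cancel_self _ _)
      right_inv := fun p => Prod.ext rfl (add_add_cancel_self _ _)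
      continuous_toFun := by fun_prop
      continuous_invFun := by fun_prop }
  have h1 : Prod.snd ⁻¹' D ∈ residual ((ℕ → Bool) × (ℕ → Bool)) :=
    tendsto_residual_of_isOpenMap continuous_snd isOpenMap_snd hD
  have h2 : (fun p => (T p).2) ⁻¹' D ∈ residual ((ℕ → Bool) × (ℕ → Bool)) :=
    tendsto_residual_of_isOpenMap (continuous_snd.comp T.continuous)
      (isOpenMap_snd.comp T.isOpenMap) hD
  obtain ⟨N, V, hV, ⟨⟨w, y⟩, hwy⟩, hVU, hVN⟩ := exists_open_uniform_tail (inter_mem h1 h2)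
    ((isOpen_cylinder _ a n).preimage continuous_snd)
    ⟨(a, a), self_mem_cylinder _ _⟩ (g := fun p => f p.2) (h := fun p => f (T p).2)
    (hf.comp continuous_snd.continuousOn fun p hp => hp.1)
    (hf.comp (continuous_snd.comp T.continuous).continuousOn fun p hp => hp.2)
    fun p _ _ => hx p.2 p.1
  obtain ⟨W, hW, Y, hY, hWY⟩ := mem_nhds_prod_iff.1 (hV.mem_nhds hwy)
  obtain ⟨W', hW', hWo, hwW⟩ := mem_nhds_iff.1 hW
  obtain ⟨Y', hY', hYo, hyY⟩ := mem_nhds_iff.1 hY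
  obtain ⟨r₁, -, hr₁⟩ := exists_cylinder_subset hWo hwW 0
  obtain ⟨r₂, hr₂n, hr₂⟩ := exists_cylinder_subset hYo hyY n
  have hya : y ∈ cylinder a n := hVU hwy
  obtain ⟨b, hby, hbD⟩ := (dense_of_mem_residual hD).inter_open_nonempty _
    (isOpen_cylinder _ y (max r₁ r₂)) ⟨y, self_mem_cylinder _ _⟩
  obtain ⟨r, hr, hrN⟩ := exists_cylinder_eqOn_initial hf hbD (max r₁ r₂) N
  have hr1 : r₁ ≤ r := (le_max_left _ _).trans hr
  have hr2 : r₂ ≤ r := (le_max_right _ _).trans hr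
  have hby2 : b ∈ cylinder y r₂ := cylinder_anti y (le_max_right _ _) hby
  refine ⟨b, r, hr₂n.trans hr2, cylinder_subset_cylinder hya hr₂n hby2,
    fun m hm hxm => ⟨hm, fun y' hy' hyb => ?_⟩⟩
  let w' : ℕ → Bool := fun i => if i < r₁ then w i else false
  have hw'fin : w' ∈ finIdeal := finIdeal_of_eventually (n := r₁) fun i hi => by
    simp [w', not_lt.2 hi]
  have hw' : w' ∈ cylinder w r₁ := fun i hi => by simp [w', hi]
  have key : ∀ u ∈ cylinder w r₁, u ∈ finIdeal → ∀ v ∈ cylinder b r, v ∈ D →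
      ∀ i ≥ N, f v i = f (v + u * x) i := fun u hu hufin v hv hvD =>
    hVN (u, v) (hWY ⟨hW' (hr₁ hu), hY' (hr₂ (cylinder_subset_cylinder hby2 hr2 hv))⟩)
      ⟨hvD, hinv v hvD _ (hufin.subset fun i hi => by
        change (u i && x i) = true at hi
        change u i = true
        revert hi
        cases u i <;> simp)⟩
  have hs := single_mem_finIdeal m
  have hym : y' + Pi.single m true ∈ cylinder b r := add_mem_cylinder hyb (single_eq_false hm)
  have hymD := hinv y' hy' _ hs
  have hsx : (Pi.single m true : ℕ → Bool) * x = Pi.single m true := by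
    ext i
    by_cases him : i = m
    · subst him; simp only [Pi.mul_apply, Pi.single_eq_same, hxm]; rfl
    · simp [Pi.single_eq_of_ne him]
  funext i
  rcases lt_or_ge i N with hi | hi
  · rw [hrN _ hymD hym i hi, hrN _ hy' hyb i hi]
  · rw [key w' hw' hw'fin _ hym hymD i hi,
      key (w' + Pi.single m true) (add_mem_cylinder hw' (single_eq_false (hr1.trans hm)))
        (add_mem_finIdeal hw'fin hs) _ hyb hy' i hi, add_mul, hsx,
      add_assoc, add_comm (Pi.single m true : ℕ → Bool)]

theorem eventually_apply_add_single_mem_residual (hD : D ∈ residual (ℕ → Bool))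
    (hinv : ∀ y ∈ D, ∀ z ∈ finIdeal, y + z ∈ D) (hf : ContinuousOn f D) {x : ℕ → Bool}
    (hx : ∀ y z, ∃ N, ∀ i ≥ N, f y i = f (y + z * x) i) :
    {y | ∀ᶠ m in atTop, x m = true → f (y + Pi.single m true) = f y} ∈ residual (ℕ → Bool) := by
  let W : Set (ℕ → Bool) :=
    ⋃ p ∈ {p : (ℕ → Bool) × ℕ | ∀ m ≥ p.2, x m = true → m ∈ stableSet f D p.1 p.2},
      cylinder p.1 p.2
  have hW : IsOpen W := isOpen_biUnion fun p _ => isOpen_cylinder _ _ _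
  have hWd : Dense W := by
    refine dense_iff_inter_open.2 fun U hU ⟨a, ha⟩ => ?_
    obtain ⟨n, -, hn⟩ := exists_cylinder_subset hU ha 0
    obtain ⟨b, r, -, hb, hbr⟩ := exists_stable_cylinder hD hinv hf hx a n
    exact ⟨b, hn hb, mem_biUnion (x := (b, r)) hbr (self_mem_cylinder _ _)⟩
  filter_upwards [hD, residual_of_dense_open hW hWd] with y hy hyW
  obtain ⟨p, hp, hyp⟩ := mem_iUnion₂.1 hyW
  filter_upwards [eventually_ge_atTop p.2] with m hm hxm
  exact (hp m hm hxm).2 y hy hyp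

/-- Stable sets are directed modulo finite sets. -/
theorem exists_stableSet_union (hD : D ∈ residual (ℕ → Bool))
    (hinv : ∀ y ∈ D, ∀ z ∈ finIdeal, y + z ∈ D) (hf : ContinuousOn f D)
    (hfin : ∀ y, ∀ z ∈ finIdeal, ∃ N, ∀ i ≥ N, f y i = f (y + z) i) (a b : ℕ → Bool) (n k : ℕ) :
    ∃ c r, ∀ m ≥ r, m ∈ stableSet f D a n ∪ stableSet f D b k → m ∈ stableSet f D c r := by
  set l := max n k
  let s : ℕ → Bool := fun i => if i < l then a i + b i else false
  have hs : s ∈ finIdeal := finIdeal_of_eventually (n := l) fun i hi => by simp [s, not_lt.2 hi]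
  obtain ⟨N, V, hV, hVne, hVU, hVN⟩ := exists_open_uniform_tail hD (isOpen_cylinder _ a l)
    ⟨a, self_mem_cylinder _ _⟩ (g := f) (h := fun y => f (y + s)) hf
    (hf.comp (by fun_prop) fun y hy => hinv y hy s hs) fun y _ _ => hfin y s hs
  obtain ⟨c, hcV, hcD⟩ := (dense_of_mem_residual hD).inter_open_nonempty V hV hVne
  obtain ⟨r₁, hr₁, hr₁V⟩ := exists_cylinder_subset hV hcV l
  obtain ⟨r, hr, hrN⟩ := exists_cylinder_eqOn_initial hf hcD r₁ N
  refine ⟨c, r, fun m hm hmab => ?_⟩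
  have hlr := hr₁.trans hr
  have hca : c ∈ cylinder a l := hVU hcV
  rcases hmab with hma | hmb
  · exact stableSet_mono (cylinder_anti a (le_max_left _ _) hca) ((le_max_left _ _).trans hlr)
      hma hm
  refine ⟨hm, fun y hy hyc => ?_⟩
  have hym : y + Pi.single m true ∈ cylinder c r := add_mem_cylinder hyc (single_eq_false hm)
  have hymD := hinv y hy _ (single_mem_finIdeal m)
  have hsub := (cylinder_anti c hr).trans hr₁V
  have hysb : y + s ∈ cylinder b k := fun i hi => by
    have hil : i < l := hi.trans_le (le_max_right _ _)
    have : y i = a i := (hyc i (hil.trans_le hlr)).trans (hca i hil)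
    simp only [Pi.add_apply, s, hil, if_true, this, ← add_assoc, BooleanRing.add_self, zero_add]
  have hst := hmb.2 _ (hinv y hy s hs) hysb
  funext i
  rcases lt_or_ge i N with hi | hi
  · rw [hrN _ hymD hym i hi, hrN _ hy hyc i hi]
  · rw [hVN _ (hsub hym) hymD i hi, hVN _ (hsub hyc) hy i hi, add_right_comm, hst]

theorem apply_add_of_subset_stableSet (hinv : ∀ y ∈ D, ∀ z ∈ finIdeal, y + z ∈ D)
    (hf : ContinuousOn f D) {a x y : ℕ → Bool} {n : ℕ}
    (hx : ∀ m, x m = true → m ∈ stableSet f D a n) (hy : y ∈ D) (hya : y ∈ cylinder a n)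
    (hyx : y + x ∈ D) : f (y + x) = f y := by
  let t : ℕ → ℕ → Bool := fun j i => if i < j then x i else false
  have ht : ∀ j, t j ∈ finIdeal := fun j => finIdeal_of_eventually (n := j) fun i hi => by
    simp [t, not_lt.2 hi]
  refine eq_of_tendsto_of_continuousOn hf (u := fun j => y + t j) (fun j => hinv y hy _ (ht j)) hyx
    ?_ (Eventually.of_forall fun j => ?_)
  · refine tendsto_const_nhds.add (tendsto_pi_nhds.2 fun i => tendsto_const_nhds.congr' ?_)
    filter_upwards [eventually_gt_atTop i] with j hj
    simp [t, hj]
  · induction j with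
    | zero => congr 1; funext i; simp [t]; rfl
    | succ j ih =>
      rcases hxj : x j with _ | _
      · rw [← ih]
        congr 2
        funext i
        rcases lt_trichotomy i j with h | rfl | h
        · simp [t, h, Nat.lt_succ_of_lt h]
        · simp [t, hxj]
        · simp [t, not_lt.2 h.le, not_lt.2 (Nat.succ_le_of_lt h)]
      · have : t (j + 1) = t j + Pi.single j true := by
          funext i
          rcases lt_trichotomy i j with h | rfl | h
          · simp [t, h, Nat.lt_succ_of_lt h, Pi.single_eq_of_ne h.ne]
          · simp [t, hxj]; rfl
          · simp [t, not_lt.2 h.le, not_lt.2 (Nat.succ_le_of_lt h), Pi.single_eq_of_ne h.ne']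
        rw [this, ← add_assoc, (hx j hxj).2 _ (hinv y hy _ (ht j)), ih]
        refine add_mem_cylinder hya fun i hi => ?_
        by_contra h
        have hxi : x i = true := by
          by_contra h'
          simp_all [t]
        exact absurd (hx i hxi).1 (by omega)

end Stable

section Reduction

variable {I : Set (ℕ → Bool)}

theorem NontrivialIdeal.finIdeal_subset (hI : NontrivialIdeal I) : finIdeal ⊆ I := by
  have h : ∀ F : Finset ℕ, (fun n => decide (n ∈ F)) ∈ I := by
    intro F
    induction F using Finset.induction_on with
    | empty => simpa using hI.1.1
    | insert a s _ ih => simpa using hI.1.2.2 _ _ (hI.2.1 a) ih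
  intro z hz
  have hz : {n : ℕ | z n = true}.Finite := hz
  refine hI.1.2.1 _ _ (h hz.toFinset) fun i hi => by simpa using hi

/-- Every component of `θ` is continuous on the invariant comeager set `D`, and `θ` reduces `E_I`
to `E₃`. -/
structure ContinuousReduction (I : Set (ℕ → Bool)) (θ : ℕ → (ℕ → Bool) → ℕ → Bool)
    (D : Set (ℕ → Bool)) : Prop where
  residual_mem : D ∈ residual (ℕ → Bool)
  invariant : ∀ y ∈ D, ∀ z ∈ finIdeal, y + z ∈ D
  continuousOn : ∀ k, ContinuousOn (θ k) D
  mem_iff : ∀ y z, z ∈ I ↔ ∀ k, ∃ N, ∀ i ≥ N, θ k y i = θ k (y + z) i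

theorem finite_ne_iff {u v : ℕ → Bool} : {n | u n ≠ v n}.Finite ↔ ∃ N, ∀ i ≥ N, u i = v i := by
  constructor
  · intro h
    obtain ⟨N, hN⟩ := h.bddAbove
    refine ⟨N + 1, fun i hi => ?_⟩
    by_contra hne
    have : i ≤ N := hN hne
    omega
  · rintro ⟨N, hN⟩
    refine (finite_lt_nat N).subset fun i hi => ?_
    by_contra h
    exact hi (hN i (not_lt.1 h))

theorem exists_continuousReduction (hred : BorelReducible (EI I) E3) :
    ∃ θ D, ContinuousReduction I θ D := by
  obtain ⟨θ, hθm, hθ⟩ := hred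
  have hmeas : ∀ k n, MeasurableSet[borel (ℕ → Bool)] {x | θ x k n = true} := fun k n => by
    have ho : IsOpen {w : ℕ → ℕ → Bool | w k n = true} :=
      (isOpen_discrete ({true} : Set Bool)).preimage
        (continuous_apply_apply (ρ := fun _ _ => Bool) k n)
    exact hθm (MeasurableSpace.measurableSet_generateFrom ho)
  choose D hD hDc using fun k => exists_residual_continuousOn (hmeas k)
  have hD' := countable_iInter_mem.2 hD
  refine ⟨fun k x => θ x k, _, exists_invariant_residual hD', ?_, fun k => ?_, fun y z => ?_⟩
  · intro y hy z hz w hw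
    rw [add_assoc]
    exact hy _ (add_mem_finIdeal hz hw)
  · refine (hDc k).mono fun y hy => ?_
    have h0 := hy 0 (by simp [finIdeal, Bool.zero_eq_false])
    rw [add_zero] at h0
    exact mem_iInter.1 h0 k
  · have h := hθ y (y + z)
    have hz : (fun a => y a != (y + z) a) = z := by
      change y + (y + z) = z
      rw [add_comm, add_comm y z, add_add_cancel_self]
    rw [EI, hz] at h
    simp only [h, E3, finite_ne_iff]

namespace ContinuousReduction

variable {θ : ℕ → (ℕ → Bool) → ℕ → Bool} {D : Set (ℕ → Bool)}

theorem exists_eq_of_mem (h : ContinuousReduction I θ D) (hI : IsIdeal I) {x : ℕ → Bool}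
    (hx : x ∈ I) (k : ℕ) (y z : ℕ → Bool) : ∃ N, ∀ i ≥ N, θ k y i = θ k (y + z * x) i :=
  (h.mem_iff y (z * x)).1 (hI.2.1 _ _ hx fun i hi => by
    change (z i && x i) = true at hi
    exact (Bool.and_eq_true_iff.1 hi).2) k

/-- From infinitely many infinite sets in the ideal one can pick increasing representatives that
form a set in the ideal. -/
theorem exists_strictMono_mem (h : ContinuousReduction I θ D) (hI : NontrivialIdeal I)
    {M : ℕ → ℕ → Bool} (hM : ∀ j, M j ∈ I) (hinf : ∀ j, {i | M j i = true}.Infinite) :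
    ∃ m : ℕ → ℕ, StrictMono m ∧ (∀ j, M j (m j) = true) ∧ ∃ c ∈ I, ∀ j, c (m j) = true := by
  classical
  obtain ⟨t, htD, ht, htd⟩ := mem_residual.1 h.residual_mem
  obtain ⟨U, hU, rfl⟩ := isGδ_iff_eq_iInter_nat.1 ht
  obtain ⟨y, hy⟩ := (dense_of_mem_residual (exists_invariant_residual (inter_mem
    (mem_residual.2 ⟨_, Subset.rfl, ht, htd⟩)
    (countable_iInter_mem.2 fun j => countable_iInter_mem.2 fun l =>
      eventually_apply_add_single_mem_residual h.residual_mem h.invariant (h.continuousOn l)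
        (h.exists_eq_of_mem hI.1 (hM j) l))))).nonempty
  let χ : Finset ℕ → ℕ → Bool := fun F i => decide (i ∈ F)
  have hχ : ∀ F, χ F ∈ finIdeal := fun F => F.finite_toSet.subset fun i hi => by simpa [χ] using hi
  have step : ∀ j (F : Finset ℕ), ∃ m, M j m = true ∧ (∀ i ∈ F, i < m) ∧
      cylinder (y + χ F) m ⊆ U j ∧
      ∀ l ≤ j, θ l (y + χ F + Pi.single m true) = θ l (y + χ F) := by
    intro j F
    obtain ⟨hyU, hyS⟩ := hy _ (hχ F)
    obtain ⟨n, -, hn⟩ := exists_cylinder_subset (hU j) (mem_iInter.1 hyU j) 0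
    have h1 : ∀ᶠ m in atTop, ∀ l ∈ {l | l ≤ j}, M j m = true →
        θ l (y + χ F + Pi.single m true) = θ l (y + χ F) :=
      (eventually_all_finite (finite_le_nat j)).2 fun l _ => mem_iInter.1 (mem_iInter.1 hyS j) l
    have h2 : ∀ᶠ m in atTop, ∀ i ∈ F, i < m :=
      (eventually_all_finset F).2 fun i _ => eventually_gt_atTop i
    obtain ⟨m, hm, hm1, hm2, hm3⟩ := ((Nat.frequently_atTop_iff_infinite.2 (hinf j)).and_eventually
      (h1.and (h2.and (eventually_ge_atTop n)))).exists
    exact ⟨m, hm, hm2, (cylinder_anti _ hm3).trans hn, fun l hl => hm1 l hl hm⟩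
  choose g hgM hgF hgU hgθ using step
  let p : ℕ → Finset ℕ := fun j => Nat.rec ∅ (fun j F => insert (g j F) F) j
  have hp : ∀ j, p (j + 1) = insert (g j (p j)) (p j) := fun _ => rfl
  let m : ℕ → ℕ := fun j => g j (p j)
  have hmp : ∀ j i, i ∈ p j ↔ ∃ l < j, m l = i := by
    intro j
    induction j with
    | zero => simp [p]
    | succ j ih =>
      intro i
      rw [hp, Finset.mem_insert, ih]
      constructor
      · rintro (rfl | ⟨l, hl, rfl⟩)
        exacts [⟨j, j.lt_succ_self, rfl⟩, ⟨l, hl.trans j.lt_succ_self, rfl⟩]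
      · rintro ⟨l, hl, rfl⟩
        rcases Nat.lt_succ_iff_lt_or_eq.1 hl with hl | rfl
        exacts [.inr ⟨l, hl, rfl⟩, .inl rfl]
  have hmono : StrictMono m := strictMono_nat_of_lt_succ fun j =>
    hgF _ _ _ ((hmp _ _).2 ⟨j, j.lt_succ_self, rfl⟩)
  let c : ℕ → Bool := fun i => decide (∃ j, m j = i)
  refine ⟨m, hmono, fun j => hgM j _, c, ?_, fun j => by simp [c]⟩
  have hcp : ∀ j i, i < m j → c i = χ (p j) i := by
    intro j i hi
    simp only [c, χ, hmp, decide_eq_decide]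
    constructor
    · rintro ⟨l, rfl⟩
      exact ⟨l, hmono.lt_iff_lt.1 hi, rfl⟩
    · rintro ⟨l, -, hl⟩
      exact ⟨l, hl⟩
  have hycD : y + c ∈ D := htD (mem_iInter.2 fun j => hgU j (p j) fun i hi => by
    simp only [Pi.add_apply, hcp j i hi])
  have hyD : ∀ F, y + χ F ∈ D := fun F => htD (hy _ (hχ F)).1
  have hstep : ∀ l j, l ≤ j → θ l (y + χ (p j)) = θ l (y + χ (p l)) := by
    intro l j hlj
    induction j, hlj using Nat.le_induction with
    | base => rfl
    | succ j hlj ih =>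
      rw [← ih, ← hgθ j (p j) l hlj, add_assoc]
      congr 2
      funext i
      rw [hp]
      by_cases hi : i = g j (p j)
      · have : g j (p j) ∉ p j := fun hmem => (hgF j (p j) _ hmem).false
        subst hi
        simp [χ, this]
        rfl
      · simp [χ, hi]
  refine (h.mem_iff y c).2 fun k => ?_
  have hlim : θ k (y + c) = θ k (y + χ (p k)) := by
    refine eq_of_tendsto_of_continuousOn (h.continuousOn k) (u := fun j => y + χ (p j))
      (fun j => hyD _) hycD ?_ ((eventually_ge_atTop k).mono fun j hj => hstep k j hj)
    refine tendsto_const_nhds.add (tendsto_pi_nhds.2 fun i => tendsto_const_nhds.congr' ?_)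
    filter_upwards [eventually_gt_atTop i] with j hj
    exact hcp j i (hj.trans_le hmono.le_apply)
  rw [hlim]
  exact (h.mem_iff y _).1 (hI.finIdeal_subset (hχ _)) k

/-- For each component some stable set contains every member of the ideal modulo finite sets. -/
theorem exists_stableSet_forall_finite (h : ContinuousReduction I θ D) (hI : NontrivialIdeal I)
    (k : ℕ) : ∃ a n, ∀ x ∈ I, {i | x i = true ∧ i ∉ stableSet (θ k) D a n}.Finite := by
  by_contra! hcon
  obtain ⟨e, he⟩ := exists_surjective_nat (Finset ℕ × ℕ)
  let S : ℕ → Set ℕ := fun j => stableSet (θ k) D (fun i => decide (i ∈ (e j).1)) (e j).2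
  have hS : ∀ a n, ∃ j, stableSet (θ k) D a n = S j := by
    intro a n
    obtain ⟨j, hj⟩ := he ((Finset.range n).filter fun i => a i = true, n)
    refine ⟨j, ?_⟩
    have : cylinder a n = cylinder (fun i => decide (i ∈ (e j).1)) (e j).2 := by
      rw [hj]
      exact mem_cylinder_iff_eq.1 fun i hi => by simp [hi]
    simp only [S, stableSet, ← this]
    rw [hj]
  have hfin : ∀ y, ∀ z ∈ finIdeal, ∃ N, ∀ i ≥ N, θ k y i = θ k (y + z) i := fun y z hz =>
    (h.mem_iff y z).1 (hI.finIdeal_subset hz) k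
  have hdir : ∀ j, ∃ c r R, ∀ l ≤ j, ∀ m ≥ R, m ∈ S l → m ∈ stableSet (θ k) D c r := by
    intro j
    induction j with
    | zero => exact ⟨_, _, 0, fun l hl m _ hm => by rwa [Nat.le_zero.1 hl] at hm⟩
    | succ j ih =>
      obtain ⟨c, r, R, hR⟩ := ih
      obtain ⟨c', r', hc'⟩ := exists_stableSet_union h.residual_mem h.invariant (h.continuousOn k)
        hfin c (fun i => decide (i ∈ (e (j + 1)).1)) r (e (j + 1)).2
      refine ⟨c', r', max R r', fun l hl m hm hml => hc' m (le_of_max_le_right hm) ?_⟩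
      rcases Nat.le_succ_iff.1 hl with hl | rfl
      · exact .inl (hR l hl m (le_of_max_le_left hm) hml)
      · exact .inr hml
  have hM : ∀ j, ∃ M ∈ I, {i | M i = true}.Infinite ∧ ∀ i, M i = true → ∀ l ≤ j, i ∉ S l := by
    intro j
    obtain ⟨c, r, R, hR⟩ := hdir j
    obtain ⟨x, hx, hinf⟩ := hcon c r
    classical
    refine ⟨fun i => x i && decide (R ≤ i ∧ i ∉ stableSet (θ k) D c r),
      hI.1.2.1 _ _ hx fun i hi => (Bool.and_eq_true_iff.1 hi).1, ?_, fun i hi l hl hil => ?_⟩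
    · refine (hinf.sdiff (finite_lt_nat R)).mono fun i hi => ?_
      have h1 : R ≤ i := not_lt.1 hi.2
      simp [hi.1.1, h1, hi.1.2]
    · simp only [Bool.and_eq_true, decide_eq_true_eq] at hi
      exact hi.2.2 (hR l hl i hi.2.1 hil)
  choose M hMI hMinf hMS using hM
  obtain ⟨m, hmono, hmM, c, hcI, hcm⟩ := h.exists_strictMono_mem hI hMI hMinf
  obtain ⟨b, r, -, -, hb⟩ := exists_stable_cylinder h.residual_mem h.invariant (h.continuousOn k)
    (h.exists_eq_of_mem hI.1 hcI k) 0 0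
  obtain ⟨j, hj⟩ := hS b r
  rw [hj] at hb
  refine hMS (max j r) _ (hmM _) j (le_max_left _ _) (hb (m (max j r)) ?_ (hcm _))
  exact (le_max_right j r).trans hmono.le_apply

/-- The ideal consists of the sets having finite intersection with each of countably many sets. -/
theorem exists_forall_mem_iff (h : ContinuousReduction I θ D) (hI : NontrivialIdeal I) :
    ∃ A : ℕ → Set ℕ, ∀ x, x ∈ I ↔ ∀ k, {i | x i = true ∧ i ∈ A k}.Finite := by
  choose a n han using h.exists_stableSet_forall_finite hI
  refine ⟨fun k => (stableSet (θ k) D (a k) (n k))ᶜ, fun x => ⟨fun hx k => han k x hx, fun hx => ?_⟩⟩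
  obtain ⟨y, hy, hyx⟩ := (dense_of_mem_residual (inter_mem h.residual_mem
    (tendsto_residual_of_isOpenMap (Homeomorph.addRight x).continuous
      (Homeomorph.addRight x).isOpenMap h.residual_mem))).nonempty
  have hyx : y + x ∈ D := hyx
  refine (h.mem_iff y x).2 fun k => ?_
  classical
  let b : ℕ → Bool := fun i => x i && decide (i ∈ stableSet (θ k) D (a k) (n k))
  let c : ℕ → Bool := fun i => x i && !decide (i ∈ stableSet (θ k) D (a k) (n k))
  let s : ℕ → Bool := fun i => if i < n k then y i + a k i else false
  have hs : s ∈ finIdeal := finIdeal_of_eventually (n := n k) fun i hi => by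
    simp [s, not_lt.2 hi]
  have hc : c ∈ finIdeal := (hx k).subset fun i hi => by simpa [c] using hi
  have hxbc : x = c + b := by
    funext i
    change x i = (c i ^^ b i)
    simp only [b, c]
    cases x i <;> cases decide (i ∈ stableSet (θ k) D (a k) (n k)) <;> rfl
  have hys : y + s ∈ cylinder (a k) (n k) := fun i hi => by
    simp only [Pi.add_apply, s, hi, if_true, ← add_assoc, BooleanRing.add_self, zero_add]
  have hyb : y + s + b = y + x + (s + c) := by
    rw [hxbc]
    have : y + (c + b) + (s + c) = y + s + b + c + c := by abel
    rw [this, add_add_cancel_self]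
  have hstab : θ k (y + s + b) = θ k (y + s) :=
    apply_add_of_subset_stableSet h.invariant (h.continuousOn k)
      (fun m hm => by simpa [b] using (Bool.and_eq_true_iff.1 hm).2) (h.invariant y hy s hs) hys
      (by rw [hyb]; exact h.invariant _ hyx _ (add_mem_finIdeal hs hc))
  obtain ⟨N₁, h₁⟩ := (h.mem_iff y s).1 (hI.finIdeal_subset hs) k
  obtain ⟨N₂, h₂⟩ :=
    (h.mem_iff (y + x) (s + c)).1 (hI.finIdeal_subset (add_mem_finIdeal hs hc)) k
  refine ⟨max N₁ N₂, fun i hi => ?_⟩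
  rw [h₁ i (le_of_max_le_left hi), h₂ i (le_of_max_le_right hi), ← hyb, hstab]

end ContinuousReduction

end Reduction

section Classification

variable {I : Set (ℕ → Bool)}

theorem idealIso_I3ideal {g : ℕ → ℕ} (hg : ∀ j, {i | g i = j}.Infinite)
    (hI : ∀ x, x ∈ I ↔ ∀ j, {i | x i = true ∧ g i = j}.Finite) : IdealIso I I3ideal := by
  have hinf : ∀ j, Infinite {i // g i = j} := fun j => (hg j).to_subtype
  have E : ∀ j, {i // g i = j} ≃ ℕ := fun j => Classical.choice nonempty_equiv_of_countable
  let b : ℕ ≃ ℕ × ℕ := (Equiv.sigmaFiberEquiv g).symm.trans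
    ((Equiv.sigmaCongrRight E).trans (Equiv.sigmaEquivProd ℕ ℕ))
  refine ⟨b, fun x => (hI x).trans (forall_congr' fun k => ?_)⟩
  have hinj : Function.Injective fun n => b.symm (k, n) := fun n n' h => by
    simpa using h
  have himg : {i | x i = true ∧ g i = k} =
      (fun n => b.symm (k, n)) '' {n | x (b.symm (k, n)) = true} := by
    ext i
    constructor
    · rintro ⟨hxi, rfl⟩
      have hb : b i = (g i, E (g i) ⟨i, rfl⟩) := rfl
      refine ⟨E (g i) ⟨i, rfl⟩, ?_, ?_⟩
      · simpa [← hb] using hxi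
      · simp [← hb]
    · rintro ⟨n, hn, rfl⟩
      exact ⟨hn, ((E k).symm n).2⟩
  rw [himg]
  exact finite_image_iff hinj.injOn

theorem idealIso_of_forall_mem_iff_finite_inter {A : Set ℕ} (hA : A.Infinite)
    (hI : ∀ x, x ∈ I ↔ {i | x i = true ∧ i ∈ A}.Finite) :
    IdealIso I finIdeal ∨ IdealIso I finPlusFullIdeal := by
  classical
  by_cases hc : Aᶜ.Finite
  · refine .inl ⟨Equiv.refl ℕ, fun x => (hI x).trans ⟨fun h => ?_, fun h => ?_⟩⟩
    · refine (h.union hc).subset fun i (hi : x i = true) => ?_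
      by_cases hiA : i ∈ A
      exacts [.inl ⟨hi, hiA⟩, .inr hiA]
    · exact Set.Finite.subset h fun i hi => hi.1
  · have h1 : Infinite {i // i ∈ A} := hA.to_subtype
    have h2 : Infinite {i // i ∉ A} := Set.Infinite.to_subtype hc
    have h3 : Infinite {i : ℕ // Even i} := Set.Infinite.to_subtype
      (infinite_of_injective_forall_mem (f := fun n => 2 * n)
        (mul_right_injective₀ two_ne_zero) fun n => even_two_mul n)
    have h4 : Infinite {i : ℕ // ¬ Even i} := Set.Infinite.to_subtype
      (infinite_of_injective_forall_mem (f := fun n => 2 * n + 1)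
        (fun a b h => by simpa using h) fun n => Nat.not_even_two_mul_add_one n)
    obtain ⟨e⟩ := (nonempty_equiv_of_countable : Nonempty ({i // i ∈ A} ≃ {i : ℕ // Even i}))
    obtain ⟨f⟩ := (nonempty_equiv_of_countable : Nonempty ({i // i ∉ A} ≃ {i : ℕ // ¬ Even i}))
    let b : ℕ ≃ ℕ := Equiv.subtypeCongr e f
    have hb : ∀ i, Even (b i) ↔ i ∈ A := by
      intro i
      by_cases hi : i ∈ A
      · simpa [b, Equiv.subtypeCongr, hi] using (e ⟨i, hi⟩).2
      · simpa [b, Equiv.subtypeCongr, hi] using (f ⟨i, hi⟩).2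
    refine .inr ⟨b, fun x => (hI x).trans ?_⟩
    rw [← finite_image_iff b.injective.injOn]
    refine iff_of_eq (congrArg _ (Set.ext fun i => ⟨?_, fun hi => ?_⟩))
    · rintro ⟨i, ⟨hxi, hiA⟩, rfl⟩
      exact ⟨by simpa using hxi, (hb i).2 hiA⟩
    · exact ⟨b.symm i, ⟨hi.1, (hb _).1 (by simpa using hi.2)⟩, by simp⟩

theorem idealIso_of_forall_mem_iff {A : ℕ → Set ℕ} (htop : (fun _ => true) ∉ I)
    (hI : ∀ x, x ∈ I ↔ ∀ k, {i | x i = true ∧ i ∈ A k}.Finite) :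
    IdealIso I finIdeal ∨ IdealIso I finPlusFullIdeal ∨ IdealIso I I3ideal := by
  classical
  let C : ℕ → Set ℕ := fun k => {i | i ∈ A k ∧ ∀ j < k, i ∉ A j}
  have hdisj : ∀ {i k l}, i ∈ C k → i ∈ C l → k = l := fun {i k l} hk hl =>
    le_antisymm (not_lt.1 fun h => hk.2 l h hl.1) (not_lt.1 fun h => hl.2 k h hk.1)
  have hC : ∀ x, x ∈ I ↔ ∀ k, {i | x i = true ∧ i ∈ C k}.Finite := fun x => by
    rw [hI]
    refine ⟨fun h k => (h k).subset fun i hi => ⟨hi.1, hi.2.1⟩, fun h k => ?_⟩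
    refine ((finite_le_nat k).biUnion fun j _ => h j).subset fun i hi => ?_
    have hex : ∃ j, i ∈ A j := ⟨k, hi.2⟩
    exact mem_biUnion (Nat.find_min' hex hi.2)
      ⟨hi.1, Nat.find_spec hex, fun j hj => Nat.find_min hex hj⟩
  let K : Set ℕ := {k | (C k).Infinite}
  have hCK : ∀ x, x ∈ I ↔ ∀ k ∈ K, {i | x i = true ∧ i ∈ C k}.Finite := fun x => by
    rw [hC]
    refine ⟨fun h k _ => h k, fun h k => ?_⟩
    by_cases hk : k ∈ K
    · exact h k hk
    · exact (not_infinite.1 hk).subset fun i hi => hi.2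
  by_cases hK : K.Finite
  · rw [← or_assoc]
    left
    obtain ⟨k, hk⟩ : K.Nonempty := by
      by_contra hne
      exact htop ((hCK _).2 fun k hk => (hne ⟨k, hk⟩).elim)
    refine idealIso_of_forall_mem_iff_finite_inter (A := ⋃ k ∈ K, C k)
      (Set.Infinite.mono (subset_biUnion_of_mem hk) hk) fun x => ?_
    rw [hCK]
    refine ⟨fun h => (hK.biUnion h).subset fun i hi => ?_, fun h k hk => h.subset fun i hi =>
      ⟨hi.1, mem_biUnion hk hi.2⟩⟩
    obtain ⟨k, hk, hik⟩ := mem_iUnion₂.1 hi.2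
    exact mem_biUnion hk ⟨hi.1, hik⟩
  · right; right
    have : Infinite K := Set.Infinite.to_subtype hK
    obtain ⟨e⟩ := (nonempty_equiv_of_countable : Nonempty (K ≃ ℕ))
    let g : ℕ → ℕ := fun i => if h : ∃ k : K, i ∈ C k then e h.choose else i
    have hg : ∀ (k : K) i, i ∈ C k → g i = e k := fun k i hi => by
      have h : ∃ k : K, i ∈ C k := ⟨k, hi⟩
      simp only [g, dif_pos h]
      exact congrArg e (Subtype.ext (hdisj h.choose_spec hi))
    have hg' : ∀ i, i ∈ C (e.symm (g i)) ∨ g i = i := fun i => by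
      by_cases h : ∃ k : K, i ∈ C k
      · left
        rw [hg h.choose i h.choose_spec, e.symm_apply_apply]
        exact h.choose_spec
      · exact .inr (dif_neg h)
    refine idealIso_I3ideal (g := g) (fun j => Set.Infinite.mono (fun i hi => ?_) (e.symm j).2)
      fun x => (hCK x).trans ⟨fun h j => ?_, fun h k hk => ?_⟩
    · simpa using hg _ i hi
    · refine ((h _ (e.symm j).2).union (finite_singleton j)).subset ?_
      rintro i ⟨hxi, rfl⟩
      rcases hg' i with hi | hi
      exacts [.inl ⟨hxi, hi⟩, .inr hi.symm]
    · exact (h (e ⟨k, hk⟩)).subset fun i hi => ⟨hi.1, hg ⟨k, hk⟩ i hi.2⟩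

end Classification

/-- Kechris: any nontrivial Borel ideal `I` on `ℕ` with `E_I ≤B E₃` is
isomorphic to `Fin`, to `Fin ⊕ P(ℕ)`, or to `I₃`. -/
theorem ideals_below_E3
    (I : Set (ℕ → Bool)) (hI : NontrivialIdeal I)
    (hBorel : MeasurableSet[borel (ℕ → Bool)] I)
    (hred : BorelReducible (EI I) E3) :
    IdealIso I finIdeal ∨ IdealIso I finPlusFullIdeal ∨ IdealIso I I3ideal := by
  obtain ⟨θ, D, h⟩ := exists_continuousReduction hred
  obtain ⟨A, hA⟩ := h.exists_forall_mem_iff hI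
  exact idealIso_of_forall_mem_iff hI.2.2 hA
end
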